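/- Let V be a finite set, δ ∈ V, and let c : V × V → ℝ be symmetric, nonnegative, with zero diagonal, such that the graph on V whose edges are the pairs {i,j} with c_{ij} > 0 is connected. Then ∫_{ℝ^{V∖{δ}}} exp(−(1/2) Σ_{{i,j}} c_{ij}(s_i − s_j)²) ∏_{i∈V∖{δ}} (ds_i/√(2π)) = (Σ_T ∏_{{i,j}∈E(T)} c_{ij})^{−1/2}, where s_δ := 0, the sum Σ_{{i,j}} runs over unordered pairs of distinct vertices, and the sum over T runs over all spanning trees of the complete graph on V. -/

import Mathlib

/-- The set of (edge sets of) spanning trees of the complete graph on `V`,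
i.e. all trees with vertex set `V`, encoded by their edge sets. -/
noncomputable def spanningTrees (V : Type*) [Fintype V] [DecidableEq V] :
    Finset (Finset (Sym2 V)) := by
  classical
  exact Finset.univ.filter fun T =>
    (SimpleGraph.fromEdgeSet (↑T : Set (Sym2 V))).IsTree ∧ ∀ e ∈ T, ¬ e.IsDiag

/-- The spanning-tree generating polynomial `∑_T ∏_{e ∈ T} f e`. -/
noncomputable def treePoly {V : Type*} [Fintype V] [DecidableEq V] (f : Sym2 V → ℝ) : ℝ :=
  ∑ T ∈ spanningTrees V, ∏ e ∈ T, f e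

/-- `D(W,u) = ∑_T ∏_{{i,j} ∈ E(T)} W i j * exp (u i + u j)`, the sum ranging over
all spanning trees of the complete graph on `V`. -/
noncomputable def treeGen {V : Type*} [Fintype V] [DecidableEq V]
    (W : V → V → ℝ) (u : V → ℝ) (hW : ∀ i j, W i j = W j i) : ℝ :=
  treePoly (Sym2.lift ⟨fun i j => W i j * Real.exp (u i + u j),
    fun i j => by simp [hW i j, add_comm]⟩)

/-- Sum over unordered pairs of distinct vertices: for a symmetric summand `f`,
this equals `Σ_{{i,j}} f i j` (half the sum over ordered pairs of distinct vertices). -/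
noncomputable def pairSum {V : Type*} [Fintype V] [DecidableEq V] (f : V → V → ℝ) : ℝ :=
  (1 / 2) * ∑ p ∈ Finset.univ.offDiag, f p.1 p.2

/-- Extend `u : V∖{a} → ℝ` to `V → ℝ` by setting the value `0` at the pinned vertex `a`. -/
def pin {V : Type*} [DecidableEq V] (a : V) (u : {i : V // i ≠ a} → ℝ) : V → ℝ :=
  fun i => if h : i = a then 0 else u ⟨i, h⟩

open MeasureTheory

section RootedMaps

variable {V : Type*} {δ : V}

/-- A parent map `f` on `V ∖ {δ}` is rooted at `δ` if some height function strictly decreases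
along it, that is, if all its orbits end at `δ`. -/
def IsRooted (f : {i : V // i ≠ δ} → V) : Prop :=
  ∃ d : V → ℕ, ∀ i, d (f i) < d i

/-- The matrix `1 - P`, with `P` the transition matrix of `f` killed at `δ`. -/
noncomputable def stepMatrix [DecidableEq V] (f : {i : V // i ≠ δ} → V) :
    Matrix {i : V // i ≠ δ} {i : V // i ≠ δ} ℝ :=
  fun i k => (if (i : V) = k then 1 else 0) - if f i = k then 1 else 0

theorem det_stepMatrix_of_isRooted [Fintype V] [DecidableEq V] {f : {i : V // i ≠ δ} → V}
    (hf : IsRooted f) : (stepMatrix f).det = 1 := by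
  obtain ⟨d, hd⟩ := hf
  rw [Matrix.det_apply, Finset.sum_eq_single 1]
  · have hne : ∀ i, f i ≠ i := fun i h => by simpa [h] using hd i
    simp [stepMatrix, hne]
  · intro σ _ hσ
    by_contra h
    have hprod : ∏ i, stepMatrix f (σ i) i ≠ 0 := by
      intro h0
      simp [h0] at h
    have hstep : ∀ i, σ i = i ∨ f (σ i) = i := by
      intro i
      have h1 := Finset.prod_ne_zero_iff.1 hprod i (Finset.mem_univ i)
      by_contra! h2
      exact h1 (by simp [stepMatrix, h2.2, Subtype.coe_injective.ne h2.1])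
    have hle : ∀ i : {i : V // i ≠ δ}, d i ≤ d (σ i) := by
      intro i
      rcases hstep i with h1 | h1
      · rw [h1]
      · have := hd (σ i)
        rw [h1] at this
        exact this.le
    have hsum : ∑ i : {i : V // i ≠ δ}, d i = ∑ i, d (σ i) :=
      (Equiv.sum_comp σ fun i : {i : V // i ≠ δ} => d i).symm
    rw [Finset.sum_eq_sum_iff_of_le fun i _ => hle i] at hsum
    refine hσ (Equiv.ext fun i => ?_)
    rcases hstep i with h1 | h1
    · exact h1
    · have h2 := hd (σ i)
      rw [h1, ← hsum i (Finset.mem_univ i)] at h2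
      exact absurd h2 (lt_irrefl _)
  · simp

theorem det_stepMatrix_of_not_isRooted [Fintype V] [DecidableEq V] {f : {i : V // i ≠ δ} → V}
    (hf : ¬ IsRooted f) : (stepMatrix f).det = 0 := by
  classical
  let g : V → V := fun i => if h : i = δ then δ else f ⟨i, h⟩
  have hg : ∀ i : {i : V // i ≠ δ}, g i = f i := fun i => by simp [g, i.2]
  let S : V → Prop := fun i => ∀ n, g^[n] i ≠ δ
  have hS : ∀ i : {i : V // i ≠ δ}, S (f i) ↔ S i := by
    intro i
    rw [← hg]
    constructor
    · rintro h (_ | n)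
      · exact i.2
      · exact h n
    · exact fun h n => h (n + 1)
  have hSδ : ¬ S δ := fun h => h 0 rfl
  obtain ⟨a, ha⟩ : ∃ a, S a := by
    by_contra! hreach
    simp only [S, not_forall, not_not] at hreach
    refine hf ⟨fun i => Nat.find (hreach i), fun i => ?_⟩
    obtain ⟨n, hn⟩ : ∃ n, Nat.find (hreach i) = n + 1 := by
      refine Nat.exists_eq_succ_of_ne_zero fun h => i.2 ?_
      simpa [h] using Nat.find_spec (hreach i)
    have hspec := Nat.find_spec (hreach i)
    simp only [hn, Function.iterate_succ_apply, hg] at hspec ⊢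
    exact Nat.lt_succ_of_le (Nat.find_min' _ hspec)
  have haδ : a ≠ δ := fun h => hSδ (h ▸ ha)
  refine Matrix.exists_mulVec_eq_zero_iff.1 ⟨fun i => if S i then 1 else 0, ?_, ?_⟩
  · intro h
    simpa [ha] using congrFun h ⟨a, haδ⟩
  · ext i
    have hsum : ∀ j : V, ∑ k : {i : V // i ≠ δ}, (if j = k then (1 : ℝ) else 0) *
        (if S k then 1 else 0) = if S j then 1 else 0 := by
      intro j
      by_cases hj : j = δ
      · subst hj
        rw [if_neg hSδ]
        exact Finset.sum_eq_zero fun k _ => by simp [k.2.symm]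
      · rw [Finset.sum_eq_single ⟨j, hj⟩]
        · simp
        · intro k _ hk
          rw [if_neg fun h => hk (Subtype.ext h.symm), zero_mul]
        · simp
    simp only [Matrix.mulVec, dotProduct, stepMatrix, sub_mul, Finset.sum_sub_distrib, hsum, hS,
      sub_self, Pi.zero_apply]

theorem IsRooted.injective_edge {f : {i : V // i ≠ δ} → V} (hf : IsRooted f) :
    Function.Injective fun i : {i : V // i ≠ δ} => s((i : V), f i) := by
  obtain ⟨d, hd⟩ := hf
  intro i j hij
  rcases Sym2.eq_iff.1 hij with ⟨h, _⟩ | ⟨h1, h2⟩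
  · exact Subtype.ext h
  · have hi := hd i
    have hj := hd j
    rw [h2] at hi
    rw [← h1] at hj
    exact absurd hi hj.not_gt

/-- The edge set of the graph of a parent map. -/
def edgesOf [Fintype V] [DecidableEq V] (f : {i : V // i ≠ δ} → V) : Finset (Sym2 V) :=
  Finset.univ.image fun i : {i : V // i ≠ δ} => s((i : V), f i)

theorem mem_edgesOf [Fintype V] [DecidableEq V] {f : {i : V // i ≠ δ} → V} {e : Sym2 V} :
    e ∈ edgesOf f ↔ ∃ i : {i : V // i ≠ δ}, s((i : V), f i) = e := by
  simp [edgesOf]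

theorem IsRooted.eq_of_edgesOf_eq [Fintype V] [DecidableEq V] {f g : {i : V // i ≠ δ} → V}
    (hg : IsRooted g) (h : edgesOf f = edgesOf g) : f = g := by
  obtain ⟨d, hd⟩ := hg
  suffices ∀ n, ∀ i : {i : V // i ≠ δ}, d i = n → f i = g i from funext fun i => this _ i rfl
  intro n
  induction n using Nat.strong_induction_on with
  | _ n ih =>
    rintro i rfl
    have hmem : s((i : V), g i) ∈ edgesOf f := h ▸ mem_edgesOf.2 ⟨i, rfl⟩
    obtain ⟨j, hj⟩ := mem_edgesOf.1 hmem
    rcases Sym2.eq_iff.1 hj with ⟨h1, h2⟩ | ⟨h1, h2⟩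
    · rw [← h2, Subtype.ext h1]
    · have hlt := hd i
      rw [← h1] at hlt
      have h3 := hd j
      rw [← ih _ hlt j rfl, h2] at h3
      exact absurd h3 hlt.not_gt

theorem IsRooted.card_edgesOf [Fintype V] [DecidableEq V] {f : {i : V // i ≠ δ} → V}
    (hf : IsRooted f) : (edgesOf f).card + 1 = Fintype.card V := by
  rw [edgesOf, Finset.card_image_of_injective _ hf.injective_edge, Finset.card_univ,
    Fintype.card_subtype_compl, Fintype.card_subtype_eq]
  exact Nat.sub_add_cancel (Fintype.card_pos_iff.2 ⟨δ⟩)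

theorem mem_spanningTrees [Fintype V] [DecidableEq V] {T : Finset (Sym2 V)} :
    T ∈ spanningTrees V ↔
      (SimpleGraph.fromEdgeSet (T : Set (Sym2 V))).IsTree ∧ ∀ e ∈ T, ¬ e.IsDiag := by
  simp [spanningTrees]

theorem edgeSet_fromEdgeSet_of_not_isDiag {T : Set (Sym2 V)} (hT : ∀ e ∈ T, ¬ e.IsDiag) :
    (SimpleGraph.fromEdgeSet T).edgeSet = T := by
  rw [SimpleGraph.edgeSet_fromEdgeSet]
  exact sdiff_eq_left.2 (Set.disjoint_left.2 fun e he hd => hT e he hd)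

theorem card_of_mem_spanningTrees [Fintype V] [DecidableEq V] {T : Finset (Sym2 V)}
    (hT : T ∈ spanningTrees V) : T.card + 1 = Fintype.card V := by
  obtain ⟨htree, hdiag⟩ := mem_spanningTrees.1 hT
  have h := (SimpleGraph.isTree_iff_connected_and_card.1 htree).2
  rw [edgeSet_fromEdgeSet_of_not_isDiag hdiag] at h
  simpa using h

theorem IsRooted.edgesOf_mem_spanningTrees [Fintype V] [DecidableEq V]
    {f : {i : V // i ≠ δ} → V} (hf : IsRooted f) : edgesOf f ∈ spanningTrees V := by
  have hcard := hf.card_edgesOf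
  obtain ⟨d, hd⟩ := hf
  have hne : ∀ i : {i : V // i ≠ δ}, (i : V) ≠ f i := fun i h => by
    have := hd i
    rw [← h] at this
    exact lt_irrefl _ this
  have hdiag : ∀ e ∈ edgesOf f, ¬ e.IsDiag := by
    intro e he
    obtain ⟨i, rfl⟩ := mem_edgesOf.1 he
    simpa using hne i
  refine mem_spanningTrees.2 ⟨SimpleGraph.isTree_iff_connected_and_card.2 ⟨?_, ?_⟩, hdiag⟩
  · refine SimpleGraph.connected_iff_exists_forall_reachable _ |>.2 ⟨δ, ?_⟩
    suffices ∀ n i, d i = n → (SimpleGraph.fromEdgeSet (edgesOf f : Set (Sym2 V))).Reachable δ i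
      from fun i => this _ i rfl
    intro n
    induction n using Nat.strong_induction_on with
    | _ n ih =>
      rintro i rfl
      by_cases hi : i = δ
      · rw [hi]
      · refine (ih _ (hd ⟨i, hi⟩) _ rfl).trans (SimpleGraph.Adj.reachable ?_)
        refine ((SimpleGraph.fromEdgeSet_adj _).2 ⟨?_, hne ⟨i, hi⟩⟩).symm
        exact Finset.mem_coe.2 (mem_edgesOf.2 ⟨⟨i, hi⟩, rfl⟩)
  · rw [edgeSet_fromEdgeSet_of_not_isDiag hdiag]
    simpa using hcard

theorem exists_isRooted_edgesOf_eq [Fintype V] [DecidableEq V] (δ : V) {T : Finset (Sym2 V)}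
    (hT : T ∈ spanningTrees V) : ∃ f : {i : V // i ≠ δ} → V, IsRooted f ∧ edgesOf f = T := by
  have htree := (mem_spanningTrees.1 hT).1
  set G := SimpleGraph.fromEdgeSet (T : Set (Sym2 V))
  have hparent : ∀ i : {i : V // i ≠ δ}, ∃ j, G.Adj i j ∧ G.dist j δ < G.dist i δ := by
    rintro ⟨i, hi⟩
    obtain ⟨p, hp⟩ := htree.connected.exists_walk_length_eq_dist i δ
    cases p with
    | nil => exact absurd rfl hi
    | cons hadj q =>
      refine ⟨_, hadj, ?_⟩
      rw [← hp, SimpleGraph.Walk.length_cons]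
      exact Nat.lt_succ_of_le (SimpleGraph.dist_le q)
  choose f hadj hlt using hparent
  have hf : IsRooted f := ⟨fun i => G.dist i δ, hlt⟩
  refine ⟨f, hf, Finset.eq_of_subset_of_card_le (fun e he => ?_) ?_⟩
  · obtain ⟨i, rfl⟩ := mem_edgesOf.1 he
    exact Finset.mem_coe.1 ((SimpleGraph.fromEdgeSet_adj _).1 (hadj i)).1
  · have h1 := hf.card_edgesOf
    have h2 := card_of_mem_spanningTrees hT
    omega

open Classical in
theorem treePoly_eq_sum_isRooted [Fintype V] [DecidableEq V] (δ : V) (w : Sym2 V → ℝ) :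
    treePoly w = ∑ f : {i : V // i ≠ δ} → V with IsRooted f,
      ∏ i : {i : V // i ≠ δ}, w s((i : V), f i) := by
  symm
  refine Finset.sum_bij (fun f _ => edgesOf f) ?_ ?_ ?_ ?_
  · exact fun f hf => (Finset.mem_filter.1 hf).2.edgesOf_mem_spanningTrees
  · exact fun f _ g hg h => (Finset.mem_filter.1 hg).2.eq_of_edgesOf_eq h
  · intro T hT
    obtain ⟨f, hf, rfl⟩ := exists_isRooted_edgesOf_eq δ hT
    exact ⟨f, by simpa using hf, rfl⟩
  · intro f hf
    rw [edgesOf, Finset.prod_image (Finset.mem_filter.1 hf).2.injective_edge.injOn]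

end RootedMaps

theorem pin_coe {V : Type*} [DecidableEq V] (δ : V) (s : {i : V // i ≠ δ} → ℝ)
    (i : {i : V // i ≠ δ}) : pin δ s i = s i := by
  simp [pin, i.2]

theorem pin_self {V : Type*} [DecidableEq V] (δ : V) (s : {i : V // i ≠ δ} → ℝ) :
    pin δ s δ = 0 := by
  simp [pin]

section Laplacian

variable {V : Type*} [Fintype V] [DecidableEq V]

/-- The weighted Laplacian with the row and column of `δ` removed. -/
noncomputable def reducedLaplacian (δ : V) (c : V → V → ℝ) :
    Matrix {i : V // i ≠ δ} {i : V // i ≠ δ} ℝ :=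
  fun i k => ∑ j, c i j * ((if (i : V) = k then 1 else 0) - if j = k then 1 else 0)

/-- **Matrix-tree theorem** for weighted graphs. -/
theorem det_reducedLaplacian (δ : V) (c : V → V → ℝ) (hc : ∀ i j, c i j = c j i) :
    (reducedLaplacian δ c).det = treePoly (Sym2.lift ⟨c, hc⟩) := by
  classical
  let row : {i : V // i ≠ δ} → V → {i : V // i ≠ δ} → ℝ :=
    fun i j k => (if (i : V) = k then 1 else 0) - if j = k then 1 else 0
  have hrows : reducedLaplacian δ c = fun i : {i : V // i ≠ δ} => ∑ j, c i j • row i j := by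
    ext i k
    simp [reducedLaplacian, row]
  have hexpand : (reducedLaplacian δ c).det =
      ∑ f : {i : V // i ≠ δ} → V, (∏ i : {i : V // i ≠ δ}, c i (f i)) * (stepMatrix f).det := by
    rw [hrows]
    refine (Matrix.detRowAlternating.toMultilinearMap.map_sum
      fun (i : {i : V // i ≠ δ}) j => c i j • row i j).trans (Finset.sum_congr rfl fun f _ => ?_)
    exact Matrix.detRowAlternating.map_smul_univ (fun i : {i : V // i ≠ δ} => c i (f i))
      fun i => row i (f i)
  rw [hexpand, treePoly_eq_sum_isRooted δ, Finset.sum_filter]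
  refine Finset.sum_congr rfl fun f _ => ?_
  split_ifs with hf
  · simp [det_stepMatrix_of_isRooted hf]
  · rw [det_stepMatrix_of_not_isRooted hf, mul_zero]

theorem sum_eq_add_sum_ne (δ : V) (F : V → ℝ) :
    ∑ i, F i = F δ + ∑ i : {i : V // i ≠ δ}, F i := by
  rw [← Finset.add_sum_erase _ F (Finset.mem_univ δ)]
  congr 1
  exact Finset.sum_subtype _ (by simp) F

theorem reducedLaplacian_mulVec (δ : V) (c : V → V → ℝ) (s : {i : V // i ≠ δ} → ℝ)
    (i : {i : V // i ≠ δ}) :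
    (reducedLaplacian δ c).mulVec s i = ∑ j, c i j * (pin δ s i - pin δ s j) := by
  have heval : ∀ j : V, ∑ k : {i : V // i ≠ δ}, (if j = k then (1 : ℝ) else 0) * s k =
      pin δ s j := by
    intro j
    have := sum_eq_add_sum_ne δ fun k => (if j = k then (1 : ℝ) else 0) * pin δ s k
    simp only [pin_coe, pin_self, mul_zero, zero_add] at this
    rw [← this]
    simp
  simp only [Matrix.mulVec, dotProduct, reducedLaplacian, Finset.sum_mul]
  rw [Finset.sum_comm]
  refine Finset.sum_congr rfl fun j _ => ?_
  rw [← heval i, ← heval j, ← Finset.sum_sub_distrib, Finset.mul_sum]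
  exact Finset.sum_congr rfl fun k _ => by ring

theorem pairSum_eq_sum_sum {f : V → V → ℝ} (hf : ∀ i, f i i = 0) :
    pairSum f = (1 / 2) * ∑ i, ∑ j, f i j := by
  rw [pairSum, ← Fintype.sum_prod_type' f]
  congr 1
  refine Finset.sum_subset (Finset.subset_univ _) fun p _ hp => ?_
  have : p.1 = p.2 := by simpa using hp
  rw [this, hf]

theorem pairSum_eq_dotProduct (δ : V) (c : V → V → ℝ) (hc : ∀ i j, c i j = c j i)
    (s : {i : V // i ≠ δ} → ℝ) :
    pairSum (fun i j => c i j * (pin δ s i - pin δ s j) ^ 2) =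
      s ⬝ᵥ (reducedLaplacian δ c).mulVec s := by
  have hdot : s ⬝ᵥ (reducedLaplacian δ c).mulVec s =
      ∑ i, ∑ j, c i j * (pin δ s i * (pin δ s i - pin δ s j)) := by
    rw [sum_eq_add_sum_ne δ]
    simp only [dotProduct, reducedLaplacian_mulVec, pin_self, zero_mul, mul_zero,
      Finset.sum_const_zero, zero_add, Finset.mul_sum, pin_coe]
    exact Finset.sum_congr rfl fun i _ => Finset.sum_congr rfl fun j _ => by ring
  have hswap : ∑ i, ∑ j, c i j * (pin δ s i * (pin δ s i - pin δ s j)) =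
      ∑ i, ∑ j, c i j * (pin δ s j * (pin δ s j - pin δ s i)) := by
    rw [Finset.sum_comm]
    exact Finset.sum_congr rfl fun i _ => Finset.sum_congr rfl fun j _ => by rw [hc j i]
  have hadd : ∑ i, ∑ j, c i j * (pin δ s i - pin δ s j) ^ 2 =
      ∑ i, ∑ j, c i j * (pin δ s i * (pin δ s i - pin δ s j)) +
        ∑ i, ∑ j, c i j * (pin δ s j * (pin δ s j - pin δ s i)) := by
    simp only [← Finset.sum_add_distrib]
    exact Finset.sum_congr rfl fun i _ => Finset.sum_congr rfl fun j _ => by ring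
  rw [pairSum_eq_sum_sum fun i => by simp, hadd, ← hswap, ← hdot]
  ring

theorem posDef_reducedLaplacian (δ : V) (c : V → V → ℝ) (hc : ∀ i j, c i j = c j i)
    (hnn : ∀ i j, 0 ≤ c i j)
    (hconn : (SimpleGraph.fromRel (fun i j => 0 < c i j)).Connected) :
    (reducedLaplacian δ c).PosDef := by
  refine Matrix.PosDef.of_dotProduct_mulVec_pos ?_ fun s hs => ?_
  · ext i k
    simp only [Matrix.conjTranspose_apply, star_trivial, reducedLaplacian, mul_sub,
      Finset.sum_sub_distrib, mul_ite, mul_one, mul_zero, Finset.sum_ite_eq', Finset.mem_univ,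
      if_true]
    rw [hc k i]
    congr 1
    by_cases hik : i = k
    · rw [hik]
    · have h1 : (i : V) ≠ k := Subtype.coe_injective.ne hik
      simp [h1, h1.symm]
  · rw [star_trivial, ← pairSum_eq_dotProduct δ c hc, pairSum]
    have hterm : ∀ p ∈ (Finset.univ : Finset V).offDiag,
        0 ≤ c p.1 p.2 * (pin δ s p.1 - pin δ s p.2) ^ 2 :=
      fun p _ => mul_nonneg (hnn _ _) (sq_nonneg _)
    refine mul_pos (by norm_num) ((Finset.sum_nonneg hterm).lt_of_ne' fun h0 => hs ?_)
    rw [Finset.sum_eq_zero_iff_of_nonneg hterm] at h0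
    have hadj : ∀ i j, (SimpleGraph.fromRel (fun i j => 0 < c i j)).Adj i j →
        pin δ s i = pin δ s j := by
      intro i j hij
      rw [SimpleGraph.fromRel_adj] at hij
      have hpos : 0 < c i j := hij.2.elim id fun h => hc i j ▸ h
      have := h0 (i, j) (by simpa using hij.1)
      simpa [hpos.ne', sub_eq_zero] using this
    ext i
    have hconst : ∀ j k, pin δ s j = pin δ s k := by
      intro j k
      obtain ⟨p⟩ := hconn.preconnected j k
      induction p with
      | nil => rfl
      | cons h _ ih => exact (hadj _ _ h).trans ih
    simpa [pin_coe, pin_self] using hconst i δ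

end Laplacian

theorem integral_exp_neg_half_sq : ∫ x : ℝ, Real.exp (-(1 / 2) * x ^ 2) = √(2 * Real.pi) := by
  rw [integral_gaussian]
  congr 1
  ring

open scoped MatrixOrder Matrix.Norms.L2Operator in
/-- The normalized Gaussian integral of a positive definite quadratic form. -/
theorem integral_exp_neg_half_dotProduct_mulVec {ι : Type*} [Fintype ι] [DecidableEq ι]
    {M : Matrix ι ι ℝ} (hM : M.PosDef) :
    ∫ s : ι → ℝ, Real.exp (-(1 / 2) * (s ⬝ᵥ M.mulVec s)) * ∏ _i : ι, (√(2 * Real.pi))⁻¹ =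
      (√M.det)⁻¹ := by
  obtain ⟨A, rfl⟩ : ∃ A : Matrix ι ι ℝ, M = A.conjTranspose * A :=
    CStarAlgebra.nonneg_iff_eq_star_mul_self.1 hM.posSemidef.nonneg
  have hdet : (A.conjTranspose * A).det = A.det ^ 2 := by
    rw [Matrix.det_mul, Matrix.conjTranspose_eq_transpose_of_trivial, Matrix.det_transpose, sq]
  have hA : A.det ≠ 0 := fun h => by simpa [hdet, h] using hM.det_pos
  let g : (ι → ℝ) → ℝ := fun x => ∏ i, (Real.exp (-(1 / 2) * x i ^ 2) * (√(2 * Real.pi))⁻¹)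
  have hg : ∀ s : ι → ℝ, Real.exp (-(1 / 2) * (s ⬝ᵥ (A.conjTranspose * A).mulVec s)) *
      ∏ _i : ι, (√(2 * Real.pi))⁻¹ = g (Matrix.toLin' A s) := by
    intro s
    simp only [g, Finset.prod_mul_distrib, ← Real.exp_sum, ← Finset.mul_sum]
    rw [Matrix.conjTranspose_eq_transpose_of_trivial, ← Matrix.mulVec_mulVec,
      Matrix.dotProduct_mulVec, Matrix.vecMul_transpose]
    simp [dotProduct, sq]
  have hgint : ∫ x, g x = 1 := by
    rw [integral_fintype_prod_volume_eq_prod fun (_ : ι) (x : ℝ) =>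
      Real.exp (-(1 / 2) * x ^ 2) * (√(2 * Real.pi))⁻¹]
    refine Finset.prod_eq_one fun i _ => ?_
    rw [integral_mul_const, integral_exp_neg_half_sq]
    exact mul_inv_cancel₀ (by positivity)
  have hgm : Continuous g := by fun_prop
  simp only [hg]
  rw [← integral_map (LinearMap.continuous_on_pi _).aemeasurable hgm.aestronglyMeasurable,
    Real.map_matrix_volume_pi_eq_smul_volume_pi hA, integral_smul_measure, hgint, hdet,
    Real.sqrt_sq_eq_abs, ENNReal.toReal_ofReal (abs_nonneg _), abs_inv, smul_eq_mul, mul_one]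

/-- **Gaussian integral and the spanning-tree polynomial** (Statement 8).
For connected nonnegative symmetric conductances `c`, the pinned Gaussian integral of
`exp(-(1/2) Σ_{{i,j}} c_{ij} (s_i - s_j)²)` with `s_δ = 0` equals
`(Σ_T ∏_{{i,j} ∈ E(T)} c_{ij})^{-1/2}`. -/
theorem gaussian_integral_treePoly {V : Type*} [Fintype V] [DecidableEq V]
    (δ : V) (c : V → V → ℝ) (hc : ∀ i j, c i j = c j i)
    (hnn : ∀ i j, 0 ≤ c i j) (hdiag : ∀ i, c i i = 0)
    (hconn : (SimpleGraph.fromRel (fun i j => 0 < c i j)).Connected) :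
    (∫ s : {i : V // i ≠ δ} → ℝ,
        Real.exp (-(1 / 2) * pairSum (fun i j => c i j * (pin δ s i - pin δ s j) ^ 2))
          * ∏ _i : {i : V // i ≠ δ}, (Real.sqrt (2 * Real.pi))⁻¹)
      = (Real.sqrt (treePoly (Sym2.lift ⟨c, hc⟩)))⁻¹ := by
  simp only [pairSum_eq_dotProduct δ c hc]
  rw [integral_exp_neg_half_dotProduct_mulVec (posDef_reducedLaplacian δ c hc hnn hconn),
    det_reducedLaplacian δ c hc]
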